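/- Let T be a tree of order n ≥ 3 with ℓ leaves and w ≥ 2 NT vertices, and suppose that D_T ≥ 5, where D_T is the minimum distance in T between two leaves adjacent to distinct NT vertices. Then gp(μ(T)) = n + ℓ − w. -/

import Mathlib

open SimpleGraph

variable {V : Type*}

/-- The Mycielskian of a graph `G`: vertices are `some (Sum.inl v)` (original vertices),
`some (Sum.inr v)` (twin vertices), and `none` (the root `u*`). -/
def Mycielskian (G : SimpleGraph V) : SimpleGraph (Option (V ⊕ V)) :=
  SimpleGraph.fromRel (fun x y =>
    (∃ u v, G.Adj u v ∧ x = some (Sum.inl u) ∧ y = some (Sum.inl v)) ∨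
    (∃ u v, G.Adj u v ∧ x = some (Sum.inl u) ∧ y = some (Sum.inr v)) ∨
    (∃ u, x = some (Sum.inr u) ∧ y = none))

/-- `S` is a general position set: no shortest path between two vertices of `S`
contains a third element of `S`. -/
def IsGPSet (G : SimpleGraph V) (S : Set V) : Prop :=
  ∀ u ∈ S, ∀ v ∈ S, ∀ p : G.Walk u v, p.length = G.dist u v →
    ∀ w ∈ S, w ∈ p.support → w = u ∨ w = v

/-- The general position number of `G`: the maximum cardinality of a general position set. -/
noncomputable def gpNumber (G : SimpleGraph V) [Fintype V] : ℕ :=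
  sSup {k | ∃ S : Set V, IsGPSet G S ∧ S.ncard = k}

/-- A gp-set: a general position set of maximum cardinality. -/
def IsGpSet (G : SimpleGraph V) [Fintype V] (S : Set V) : Prop :=
  IsGPSet G S ∧ S.ncard = gpNumber G

/-- A leaf of a graph: a vertex of degree one. -/
def IsLeafVert (G : SimpleGraph V) (v : V) : Prop :=
  (G.neighborSet v).ncard = 1

/-- A next-to-terminal (NT) vertex: a vertex adjacent to a leaf. -/
def IsNTVert (G : SimpleGraph V) (v : V) : Prop :=
  ∃ u, G.Adj v u ∧ IsLeafVert G u

section Distances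

variable {G : SimpleGraph V}

lemma SimpleGraph.Walk.le_add_length {f : V → ℕ} (hf : ∀ x y, G.Adj x y → f y ≤ f x + 1) {x y : V}
    (p : G.Walk x y) : f y ≤ f x + p.length := by
  induction p with
  | nil => simp
  | cons h p ih =>
    have := hf _ _ h
    simp only [Walk.length_cons]
    omega

lemma SimpleGraph.Connected.le_add_dist (hG : G.Connected) {f : V → ℕ}
    (hf : ∀ x y, G.Adj x y → f y ≤ f x + 1) (x y : V) : f y ≤ f x + G.dist x y := by
  obtain ⟨p, hp⟩ := hG.exists_walk_length_eq_dist x y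
  exact hp ▸ p.le_add_length hf

lemma SimpleGraph.Connected.exists_adj_dist_succ (hG : G.Connected) {u v : V} (h : u ≠ v) :
    ∃ x, G.Adj u x ∧ G.dist x v + 1 = G.dist u v := by
  obtain ⟨p, hp⟩ := hG.exists_walk_length_eq_dist u v
  cases p with
  | nil => exact absurd rfl h
  | @cons _ x _ hux q =>
    refine ⟨x, hux, ?_⟩
    have h₁ := dist_le q
    have h₂ := hG.dist_triangle (u := u) (v := x) (w := v)
    rw [dist_eq_one_iff_adj.2 hux] at h₂
    simp only [Walk.length_cons] at hp
    omega

lemma SimpleGraph.Connected.exists_adj_adj_of_dist_eq_two (hG : G.Connected) {u v : V}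
    (h : G.dist u v = 2) : ∃ x, G.Adj u x ∧ G.Adj x v := by
  have hne : u ≠ v := by rintro rfl; simp at h
  obtain ⟨x, hx, hxv⟩ := hG.exists_adj_dist_succ hne
  exact ⟨x, hx, dist_eq_one_iff_adj.1 (by omega)⟩

/-- In a connected graph, general position only depends on the metric: no element of the set lies
metrically between two others. -/
lemma isGPSet_iff_dist (hG : G.Connected) (S : Set V) :
    IsGPSet G S ↔ ∀ x ∈ S, ∀ y ∈ S, ∀ w ∈ S,
      G.dist x w + G.dist w y = G.dist x y → w = x ∨ w = y := by
  classical
  constructor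
  · intro h x hx y hy w hw hd
    obtain ⟨p, hp⟩ := hG.exists_walk_length_eq_dist x w
    obtain ⟨q, hq⟩ := hG.exists_walk_length_eq_dist w y
    exact h x hx y hy (p.append q) (by rw [Walk.length_append]; omega) w hw (by simp)
  · intro h x hx y hy p hp w hw hwp
    refine h x hx y hy w hw ?_
    have h₁ := dist_le (p.takeUntil w hwp)
    have h₂ := dist_le (p.dropUntil w hwp)
    have h₃ := congrArg Walk.length (p.take_spec hwp)
    have h₄ := hG.dist_triangle (u := x) (v := w) (w := y)
    rw [Walk.length_append] at h₃
    omega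

end Distances

section Trees

variable {T : SimpleGraph V}

lemma SimpleGraph.IsTree.dist_eq_length (hT : T.IsTree) {u v : V} {p : T.Walk u v}
    (hp : p.IsPath) : T.dist u v = p.length := by
  obtain ⟨q, hq, hd⟩ := hT.connected.exists_path_of_dist u v
  have := (hT.isAcyclic.subsingleton_path u v).elim ⟨p, hp⟩ ⟨q, hq⟩
  rw [← hd, Subtype.mk.inj this]

lemma SimpleGraph.IsTree.dist_eq_two (hT : T.IsTree) {a x b : V} (h₁ : T.Adj a x)
    (h₂ : T.Adj x b) (hab : a ≠ b) : T.dist a b = 2 := by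
  refine hT.dist_eq_length (p := .cons h₁ (.cons h₂ .nil)) ?_
  rw [hT.isAcyclic.isPath_iff_isChain]
  simp [h₂.ne, hab]

lemma SimpleGraph.IsTree.dist_eq_three (hT : T.IsTree) {a x b y : V} (h₁ : T.Adj a x)
    (h₂ : T.Adj x b) (h₃ : T.Adj b y) (hab : a ≠ b) (hxy : x ≠ y) : T.dist a y = 3 := by
  refine hT.dist_eq_length (p := .cons h₁ (.cons h₂ (.cons h₃ .nil))) ?_
  rw [hT.isAcyclic.isPath_iff_isChain]
  simp [h₂.ne, h₃.ne, hab, hxy]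

lemma SimpleGraph.IsTree.dist_eq_four (hT : T.IsTree) {a x b y c : V} (h₁ : T.Adj a x)
    (h₂ : T.Adj x b) (h₃ : T.Adj b y) (h₄ : T.Adj y c) (hab : a ≠ b) (hxy : x ≠ y)
    (hbc : b ≠ c) : T.dist a c = 4 := by
  refine hT.dist_eq_length (p := .cons h₁ (.cons h₂ (.cons h₃ (.cons h₄ .nil)))) ?_
  rw [hT.isAcyclic.isPath_iff_isChain]
  simp [h₂.ne, h₃.ne, h₄.ne, hab, hxy, hbc]

/-- The neighbour of `v` on the way to `r` is unique in a tree. -/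
lemma SimpleGraph.IsTree.eq_of_adj_of_dist (hT : T.IsTree) {r v p q : V} (hp : T.Adj p v)
    (hq : T.Adj q v) (hdp : T.dist r v = T.dist r p + 1) (hdq : T.dist r v = T.dist r q + 1) :
    p = q := by
  obtain ⟨P, hP⟩ := hT.connected.exists_walk_length_eq_dist r p
  obtain ⟨Q, hQ⟩ := hT.connected.exists_walk_length_eq_dist r q
  have hP' := (P.concat hp).isPath_of_length_eq_dist (by simp [hP, hdp])
  have hQ' := (Q.concat hq).isPath_of_length_eq_dist (by simp [hQ, hdq])
  have := Subtype.mk.inj ((hT.isAcyclic.subsingleton_path r v).elim ⟨_, hP'⟩ ⟨_, hQ'⟩)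
  simpa using congrArg Walk.penultimate this

lemma IsLeafVert.eq_of_adj {l x y : V} (hl : IsLeafVert T l) (hx : T.Adj l x)
    (hy : T.Adj l y) : x = y := by
  obtain ⟨z, hz⟩ := Set.ncard_eq_one.1 hl
  have h₁ : x ∈ T.neighborSet l := hx
  have h₂ : y ∈ T.neighborSet l := hy
  rw [hz] at h₁ h₂
  rw [Set.mem_singleton_iff.1 h₁, Set.mem_singleton_iff.1 h₂]

lemma exists_adj_ne_of_not_isLeafVert {a c : V} (ha : ¬ IsLeafVert T a) (hc : T.Adj a c) :
    ∃ c', T.Adj a c' ∧ c' ≠ c := by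
  by_contra! h
  refine ha (Set.ncard_eq_one.2 ⟨c, ?_⟩)
  ext x
  exact ⟨fun hx ↦ h x hx, fun hx ↦ Set.mem_singleton_iff.1 hx ▸ hc⟩

/-- Let `X` be a set of vertices of a tree such that no two leaves in `X` share a neighbour and
no three elements of `X` are equally spaced at distance two on a path. Then `X` has a system of
distinct neighbours. -/
lemma exists_injOn_adj [Nontrivial V] (hT : T.IsTree) (X : Set V)
    (hleaf : ∀ l ∈ X, ∀ l' ∈ X, IsLeafVert T l → IsLeafVert T l' →
      ∀ y, T.Adj y l → T.Adj y l' → l = l')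
    (hpath : ∀ a ∈ X, ∀ b ∈ X, ∀ c ∈ X, ∀ x y, T.Adj a x → T.Adj x b → T.Adj b y → T.Adj y c →
      a ≠ b → x ≠ y → b = c) :
    ∃ f : V → V, (∀ a ∈ X, T.Adj a (f a)) ∧ Set.InjOn f X := by
  classical
  obtain ⟨r⟩ := hT.connected.nonempty
  let Child (c a : V) : Prop := T.Adj a c ∧ T.dist r c = T.dist r a + 1
  have hpar : ∀ {c a b}, Child c a → Child c b → a = b := fun h h' ↦
    hT.eq_of_adj_of_dist h.1 h'.1 h.2 h'.2
  have hadj : ∀ {a b}, T.Adj a b → Child a b ∨ Child b a := fun {a b} h ↦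
    (hT.dist_eq_dist_add_one_of_adj r h).imp (fun h' ↦ ⟨h.symm, h'⟩) (fun h' ↦ ⟨h, h'⟩)
  have hne : ∀ {a b c}, Child a b → Child b c → a ≠ c := by
    rintro a b c h h' rfl
    have h₁ := h.2
    have h₂ := h'.2
    omega
  let Up (a : V) : Prop := ∀ c, Child c a → ∃ l, Child l c ∧ l ∈ X ∧ IsLeafVert T l
  have key : ∀ a, ∃ b, a ∈ X → T.Adj a b ∧
      ((Child b a ∧ ∀ l, Child l b → l ∈ X → ¬ IsLeafVert T l) ∨ (Child a b ∧ Up a)) := by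
    intro a
    by_cases h : ∃ b, Child b a ∧ ∀ l, Child l b → l ∈ X → ¬ IsLeafVert T l
    · obtain ⟨b, hb⟩ := h
      exact ⟨b, fun _ ↦ ⟨hb.1.1, .inl hb⟩⟩
    have hup : Up a := by simpa [Up] using h
    by_cases har : a = r
    · subst har
      refine ⟨a, fun ha ↦ ?_⟩
      exfalso
      have hch : ∀ {c}, T.Adj a c → Child c a := fun {c} hc ↦
        ⟨hc, by rw [dist_eq_one_iff_adj.2 hc, dist_self]⟩
      obtain ⟨c, hc⟩ := hT.connected.preconnected.exists_adj_of_nontrivial a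
      obtain ⟨l, hlc, hlX, hl⟩ := hup c (hch hc)
      by_cases hal : IsLeafVert T a
      · exact hne hlc (hch hc) (hleaf l hlX a ha hl hal c hlc.1 hc.symm)
      · obtain ⟨c', hc', hcc'⟩ := exists_adj_ne_of_not_isLeafVert hal hc
        obtain ⟨l', hlc', hlX', -⟩ := hup c' (hch hc')
        exact hne hlc' (hch hc') (hpath l hlX a ha l' hlX' c c' hlc.1.symm hc.symm hc' hlc'.1
          (hne hlc (hch hc)) hcc'.symm).symm
    · obtain ⟨p, hp, hd⟩ := hT.connected.exists_adj_dist_succ har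
      rw [dist_comm, dist_comm (u := a)] at hd
      exact ⟨p, fun _ ↦ ⟨hp, .inr ⟨⟨hp.symm, hd.symm⟩, hup⟩⟩⟩
  choose f hf using key
  have grandchild : ∀ {b p}, Child b p → Up b → ¬ IsLeafVert T b →
      ∃ c l, Child c b ∧ Child l c ∧ l ∈ X := by
    intro b p hbp hup hb
    obtain ⟨c, hc, hcp⟩ := exists_adj_ne_of_not_isLeafVert hb hbp.1.symm
    have hcb : Child c b := (hadj hc).resolve_left fun h ↦ hcp (hpar h hbp)
    obtain ⟨l, hlc, hlX, -⟩ := hup c hcb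
    exact ⟨c, l, hcb, hlc, hlX⟩
  have bad : ∀ {a b p}, a ∈ X → b ∈ X → T.Adj a p → Child b p → Up b → a ≠ b →
      ¬ IsLeafVert T b → False := by
    intro a b p ha hb hap hbp hup hab hnl
    obtain ⟨c, l, hcb, hlc, hlX⟩ := grandchild hbp hup hnl
    exact hne hlc hcb (hpath a ha b hb l hlX p c hap hbp.1 hcb.1 hlc.1 hab
      (hne hcb hbp).symm).symm
  refine ⟨f, fun a ha ↦ (hf a ha).1, fun a ha b hb hab ↦ ?_⟩
  by_contra hne'
  obtain ⟨haf, ha'⟩ := hf a ha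
  obtain ⟨hbf, hb'⟩ := hf b hb
  rw [← hab] at hbf hb'
  rcases ha' with ⟨ha₁, ha₂⟩ | ⟨ha₁, ha₂⟩ <;> rcases hb' with ⟨hb₁, hb₂⟩ | ⟨hb₁, hb₂⟩
  · exact hne' (hpar ha₁ hb₁)
  · exact bad ha hb haf hb₁ hb₂ hne' (ha₂ b hb₁ hb)
  · exact bad hb ha hbf ha₁ ha₂ (Ne.symm hne') (hb₂ a ha₁ ha)
  · by_cases hal : IsLeafVert T a
    · by_cases hbl : IsLeafVert T b
      · exact hne' (hleaf a ha b hb hal hbl _ haf.symm hbf.symm)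
      · exact bad ha hb haf hb₁ hb₂ hne' hbl
    · exact bad hb ha hbf ha₁ ha₂ (Ne.symm hne') hal

end Trees

section Mycielskian

variable {G : SimpleGraph V}

@[simp] lemma mycielskian_adj_inl_inl {u v : V} :
    (Mycielskian G).Adj (some (.inl u)) (some (.inl v)) ↔ G.Adj u v := by
  simp only [Mycielskian, fromRel_adj]
  constructor
  · rintro ⟨-, h⟩
    simpa [G.adj_comm v u] using h
  · intro h
    simp [h, h.symm, h.ne]

@[simp] lemma mycielskian_adj_inl_inr {u v : V} :
    (Mycielskian G).Adj (some (.inl u)) (some (.inr v)) ↔ G.Adj u v := by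
  simp [Mycielskian]

@[simp] lemma mycielskian_adj_inr_inl {u v : V} :
    (Mycielskian G).Adj (some (.inr u)) (some (.inl v)) ↔ G.Adj u v := by
  rw [adj_comm, mycielskian_adj_inl_inr, adj_comm]

@[simp] lemma not_mycielskian_adj_inr_inr {u v : V} :
    ¬ (Mycielskian G).Adj (some (.inr u)) (some (.inr v)) := by
  simp [Mycielskian]

@[simp] lemma mycielskian_adj_inr_none {u : V} :
    (Mycielskian G).Adj (some (.inr u)) none := by
  simp [Mycielskian]

@[simp] lemma mycielskian_adj_none_inr {u : V} :
    (Mycielskian G).Adj none (some (.inr u)) := by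
  simp [Mycielskian]

@[simp] lemma not_mycielskian_adj_inl_none {u : V} :
    ¬ (Mycielskian G).Adj (some (.inl u)) none := by
  simp [Mycielskian]

@[simp] lemma not_mycielskian_adj_none_inl {u : V} :
    ¬ (Mycielskian G).Adj none (some (.inl u)) := by
  simp [Mycielskian]

lemma mycielskian_connected [Nontrivial V] (hG : G.Connected) : (Mycielskian G).Connected := by
  have key : ∀ x, (Mycielskian G).Reachable x none := by
    rintro (_ | u | u)
    · rfl
    · obtain ⟨v, hv⟩ := hG.preconnected.exists_adj_of_nontrivial u
      exact (mycielskian_adj_inl_inr.2 hv).reachable.trans mycielskian_adj_inr_none.reachable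
    · exact mycielskian_adj_inr_none.reachable
  exact ⟨fun x y ↦ (key x).trans (key y).symm⟩

lemma dist_mycielskian_none_inr (u : V) : (Mycielskian G).dist none (some (.inr u)) = 1 :=
  dist_eq_one_iff_adj.2 mycielskian_adj_none_inr

lemma dist_mycielskian_none_inl [Nontrivial V] (hG : G.Connected) (u : V) :
    (Mycielskian G).dist none (some (.inl u)) = 2 := by
  have hM := mycielskian_connected hG
  obtain ⟨v, hv⟩ := hG.preconnected.exists_adj_of_nontrivial u
  have h₁ := hM.dist_triangle (u := none) (v := some (.inr v)) (w := some (.inl u))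
  rw [dist_mycielskian_none_inr, dist_eq_one_iff_adj.2 (mycielskian_adj_inr_inl.2 hv.symm)] at h₁
  have h₂ := hM.one_lt_dist_of_ne_of_not_adj (u := none) (v := some (.inl u)) (by simp) (by simp)
  omega

lemma dist_mycielskian_inr_inr [Nontrivial V] (hG : G.Connected) {u v : V} (h : u ≠ v) :
    (Mycielskian G).dist (some (.inr u)) (some (.inr v)) = 2 := by
  have hM := mycielskian_connected hG
  have h₁ := hM.dist_triangle (u := some (.inr u)) (v := none) (w := some (.inr v))
  rw [dist_comm (v := none), dist_mycielskian_none_inr, dist_mycielskian_none_inr] at h₁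
  have h₂ := hM.one_lt_dist_of_ne_of_not_adj (u := some (.inr u)) (v := some (.inr v))
    (by simpa using h) (by simp)
  omega

lemma dist_mycielskian_inl_inr_self [Nontrivial V] (hG : G.Connected) (u : V) :
    (Mycielskian G).dist (some (.inl u)) (some (.inr u)) = 2 := by
  have hM := mycielskian_connected hG
  obtain ⟨v, hv⟩ := hG.preconnected.exists_adj_of_nontrivial u
  have h₁ := hM.dist_triangle (u := some (.inl u)) (v := some (.inl v)) (w := some (.inr u))
  rw [dist_eq_one_iff_adj.2 (mycielskian_adj_inl_inl.2 hv),
    dist_eq_one_iff_adj.2 (mycielskian_adj_inl_inr.2 hv.symm)] at h₁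
  have h₂ := hM.one_lt_dist_of_ne_of_not_adj (u := some (.inl u)) (v := some (.inr u))
    (by simp) (by simp)
  omega

lemma dist_mycielskian_inl_inl_le (hG : G.Connected) (u v : V) :
    (Mycielskian G).dist (some (.inl u)) (some (.inl v)) ≤ G.dist u v := by
  obtain ⟨p, hp⟩ := hG.exists_walk_length_eq_dist u v
  let φ : G →g Mycielskian G := ⟨fun x ↦ some (.inl x), fun h ↦ mycielskian_adj_inl_inl.2 h⟩
  rw [← hp, ← Walk.length_map φ]
  exact dist_le (p.map φ)

open Classical in
/-- A function bounding the distance from `u` in the Mycielskian from below. -/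
noncomputable def mycielskianPotential (G : SimpleGraph V) (u : V) : Option (V ⊕ V) → ℕ
  | none => 2
  | some (.inl v) => min (G.dist u v) 4
  | some (.inr v) => if u = v then 2 else min (G.dist u v) 3

lemma mycielskianPotential_le [Nontrivial V] (hG : G.Connected) (u : V) (x : Option (V ⊕ V)) :
    mycielskianPotential G u x ≤ (Mycielskian G).dist (some (.inl u)) x := by
  have h := (mycielskian_connected hG).le_add_dist (f := mycielskianPotential G u) ?_
    (some (.inl u)) x
  · simpa [mycielskianPotential] using h
  have hadj : ∀ {v w}, G.Adj v w → G.dist u w ≤ G.dist u v + 1 := fun {v w} h ↦ by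
    have := hG.dist_triangle (u := u) (v := v) (w := w)
    rwa [dist_eq_one_iff_adj.2 h] at this
  have hpos : ∀ {v}, u ≠ v → 0 < G.dist u v := fun h ↦ hG.pos_dist_of_ne h
  rintro (_ | v | v) (_ | w | w) h <;> simp at h <;> simp only [mycielskianPotential]
  · split_ifs <;> omega
  · have := hadj h; omega
  · have := hadj h
    split_ifs with huw
    · subst huw
      rw [dist_comm, dist_eq_one_iff_adj.2 h]
      simp
    · omega
  · split_ifs with huv
    · omega
    · have := hpos huv; omega
  · have := hadj h
    split_ifs with huv
    · subst huv; simp at this; omega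
    · omega

lemma dist_mycielskian_inl_inl [Nontrivial V] (hG : G.Connected) (u v : V) :
    (Mycielskian G).dist (some (.inl u)) (some (.inl v)) = min (G.dist u v) 4 := by
  have h₁ := mycielskianPotential_le hG u (some (.inl v))
  have h₂ := dist_mycielskian_inl_inl_le hG u v
  have h₃ := (mycielskian_connected hG).dist_triangle (u := some (.inl u)) (v := none)
    (w := some (.inl v))
  rw [dist_comm (v := none), dist_mycielskian_none_inl hG, dist_mycielskian_none_inl hG] at h₃
  simp only [mycielskianPotential] at h₁
  omega

lemma dist_mycielskian_inl_inr [Nontrivial V] (hG : G.Connected) {u v : V} (h : u ≠ v) :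
    (Mycielskian G).dist (some (.inl u)) (some (.inr v)) = min (G.dist u v) 3 := by
  have hM := mycielskian_connected hG
  have h₁ := mycielskianPotential_le hG u (some (.inr v))
  simp only [mycielskianPotential, if_neg h] at h₁
  have h₂ := hM.dist_triangle (u := some (.inl u)) (v := none) (w := some (.inr v))
  rw [dist_comm (v := none), dist_mycielskian_none_inl hG, dist_mycielskian_none_inr] at h₂
  obtain ⟨x, hvx, hxu⟩ := hG.exists_adj_dist_succ h.symm
  have h₃ := hM.dist_triangle (u := some (.inl u)) (v := some (.inl x)) (w := some (.inr v))
  rw [dist_eq_one_iff_adj.2 (mycielskian_adj_inl_inr.2 hvx.symm)] at h₃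
  have h₄ := dist_mycielskian_inl_inl_le hG u x
  rw [dist_comm (u := x), dist_comm (u := v)] at hxu
  omega

/-- A set of vertices of the Mycielskian has as many elements as its root, original and twin parts
together. -/
lemma ncard_mycielskian_eq [Finite V] (S : Set (Option (V ⊕ V))) :
    S.ncard = {x | x = none ∧ x ∈ S}.ncard + {v | some (.inl v) ∈ S}.ncard +
      {v | some (.inr v) ∈ S}.ncard := by
  have hl : Function.Injective fun v : V ↦ (some (.inl v) : Option (V ⊕ V)) :=
    (Option.some_injective _).comp Sum.inl_injective
  have hr : Function.Injective fun v : V ↦ (some (.inr v) : Option (V ⊕ V)) :=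
    (Option.some_injective _).comp Sum.inr_injective
  rw [← Set.ncard_image_of_injective {v | some (.inl v) ∈ S} hl,
    ← Set.ncard_image_of_injective {v | some (.inr v) ∈ S} hr,
    ← Set.ncard_union_eq, ← Set.ncard_union_eq]
  · congr 1
    ext (_ | v | v) <;> simp
  · rw [Set.disjoint_left]
    rintro (_ | v | v) <;> simp
  · rw [Set.disjoint_left]
    rintro (_ | v | v) <;> simp

lemma ncard_mycielskian_eq_of_none_notMem [Finite V] {S : Set (Option (V ⊕ V))} (h : none ∉ S) :
    S.ncard = {v | some (.inl v) ∈ S}.ncard + {v | some (.inr v) ∈ S}.ncard := by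
  have : {x | x = none ∧ x ∈ S} = ∅ :=
    Set.eq_empty_of_forall_notMem fun x hx ↦ h (hx.1 ▸ hx.2)
  rw [ncard_mycielskian_eq, this, Set.ncard_empty, zero_add]

end Mycielskian

section UpperBound

variable [Fintype V] [Nontrivial V] {T : SimpleGraph V} {S : Set (Option (V ⊕ V))}

lemma ncard_le_of_none_mem (hT : T.IsTree) (hS : IsGPSet (Mycielskian T) S) (hroot : none ∈ S)
    {l₁ l₂ y₁ y₂ : V} (h₁ : T.Adj y₁ l₁) (h₂ : T.Adj y₂ l₂) (h : 5 ≤ T.dist l₁ l₂) :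
    S.ncard ≤ Fintype.card V := by
  have hc := hT.connected
  rw [isGPSet_iff_dist (mycielskian_connected hc)] at hS
  have hB : {v | some (.inr v) ∈ S}.ncard ≤ 1 := by
    rw [Set.ncard_le_one]
    intro u hu v hv
    by_contra huv
    have := hS _ hu _ hv none hroot (by
      rw [dist_comm (v := none), dist_mycielskian_none_inr, dist_mycielskian_none_inr,
        dist_mycielskian_inr_inr hc huv])
    simp at this
  have hA : ∀ u v, some (.inl u) ∈ S → 4 ≤ T.dist u v → some (.inl v) ∉ S := by
    intro u v hu huv hv
    have := hS _ hu _ hv none hroot (by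
      rw [dist_comm (v := none), dist_mycielskian_none_inl hc, dist_mycielskian_none_inl hc,
        dist_mycielskian_inl_inl hc]
      omega)
    simp at this
  have hR : {x | x = none ∧ x ∈ S}.ncard ≤ 1 := by
    rw [Set.ncard_le_one]
    rintro a ⟨rfl, -⟩ b ⟨rfl, -⟩
    rfl
  have hpair : ∃ p q, p ≠ q ∧ some (.inl p) ∉ S ∧ some (.inl q) ∉ S := by
    have t₁ := hc.dist_triangle (u := l₁) (v := y₂) (w := l₂)
    have t₂ := hc.dist_triangle (u := l₁) (v := y₁) (w := l₂)
    rw [dist_eq_one_iff_adj.2 h₂] at t₁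
    rw [dist_eq_one_iff_adj.2 h₁.symm] at t₂
    by_cases hl₁ : some (.inl l₁) ∈ S
    · exact ⟨y₂, l₂, h₂.ne, hA _ _ hl₁ (by omega), hA _ _ hl₁ (by omega)⟩
    by_cases hl₂ : some (.inl l₂) ∈ S
    · exact ⟨y₁, l₁, h₁.ne, hA _ _ hl₂ (by rw [dist_comm]; omega), hl₁⟩
    · exact ⟨l₁, l₂, by rintro rfl; simp at h, hl₁, hl₂⟩
  obtain ⟨p, q, hpq, hp, hq⟩ := hpair
  have hcard : {v | some (.inl v) ∈ S}.ncard + ({p, q} : Set V).ncard ≤ Fintype.card V := by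
    rw [← Set.ncard_union_eq, ← Nat.card_eq_fintype_card]
    · exact Set.ncard_le_card _
    · rw [Set.disjoint_right]
      rintro x (rfl | rfl)
      exacts [hp, hq]
  rw [Set.ncard_pair hpq] at hcard
  rw [ncard_mycielskian_eq]
  omega

lemma ncard_le_of_adj_twin_mem (hT : T.IsTree) (hS : IsGPSet (Mycielskian T) S)
    (hroot : none ∉ S) {a y : V} (hay : T.Adj a y) (ha : some (.inl a) ∈ S)
    (hy : some (.inr y) ∈ S) (hfar : IsLeafVert T a → ∃ l, 5 ≤ T.dist a l) :
    S.ncard ≤ Fintype.card V := by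
  have hc := hT.connected
  rw [isGPSet_iff_dist (mycielskian_connected hc)] at hS
  have day : T.dist a y = 1 := dist_eq_one_iff_adj.2 hay
  have e₁ : (Mycielskian T).dist (some (.inl a)) (some (.inr y)) = 1 := by
    rw [dist_mycielskian_inl_inr hc hay.ne, day]; rfl
  have e₂ : (Mycielskian T).dist (some (.inr y)) (some (.inl a)) = 1 := by
    rw [dist_comm, e₁]
  -- neighbours of `a` other than `y` are unused
  have hnA : ∀ x, T.Adj a x → some (.inl x) ∉ S := by
    intro x hx hxS
    have := hS _ hy _ hxS _ ha (by
      rw [e₂, dist_mycielskian_inl_inl hc, dist_eq_one_iff_adj.2 hx, dist_comm]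
      by_cases hxy : x = y
      · subst hxy
        rw [dist_mycielskian_inl_inr_self hc]; rfl
      · rw [dist_mycielskian_inl_inr hc hxy, hT.dist_eq_two hx.symm hay hxy]; rfl)
    simp [hx.ne] at this
  have hnB : ∀ x, T.Adj a x → x ≠ y → some (.inr x) ∉ S := by
    intro x hx hxy hxS
    have := hS _ hy _ hxS _ ha (by
      rw [e₂, dist_mycielskian_inl_inr hc hx.ne, dist_eq_one_iff_adj.2 hx,
        dist_mycielskian_inr_inr hc hxy.symm]; rfl)
    simp at this
  have hB : ∀ b, 3 ≤ T.dist a b → some (.inr b) ∉ S := by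
    intro b hab hbS
    have hyb : y ≠ b := by rintro rfl; omega
    have := hS _ ha _ hbS _ hy (by
      rw [e₁, dist_mycielskian_inr_inr hc hyb,
        dist_mycielskian_inl_inr hc (by rintro rfl; simp at hab)]
      omega)
    simp [hyb] at this
  have hAB : {v | some (.inl v) ∈ S} ∩ {v | some (.inr v) ∈ S} ⊆ {a} := by
    rintro b ⟨hbA, hbB⟩
    by_contra hba
    have hba : b ≠ a := hba
    have hpos := hc.pos_dist_of_ne hba.symm
    have h3 := mt (hB b) (not_not.2 hbB)
    have h1 : T.dist a b ≠ 1 := fun h ↦ hnA b (dist_eq_one_iff_adj.1 h) hbA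
    have h2 : T.dist a b = 2 := by omega
    obtain ⟨x, hax, hxb⟩ := hc.exists_adj_adj_of_dist_eq_two h2
    by_cases hxy : x = y
    · subst hxy
      have := hS _ ha _ hbA _ hy (by
        rw [e₁, dist_comm, dist_mycielskian_inl_inr hc hxb.ne.symm, dist_mycielskian_inl_inl hc,
          h2, dist_eq_one_iff_adj.2 hxb.symm]; rfl)
      simp at this
    · have hby := hT.dist_eq_three hxb.symm hax.symm hay hba hxy
      have := hS _ hbA _ hy _ ha (by
        rw [e₁, dist_mycielskian_inl_inl hc, dist_comm, h2,
          dist_mycielskian_inl_inr hc (by rintro rfl; simp at hby), hby]; rfl)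
      simp [hba.symm] at this
  have hz : ∃ z, some (.inl z) ∉ S ∧ some (.inr z) ∉ S := by
    by_cases hal : IsLeafVert T a
    · obtain ⟨l, hl⟩ := hfar hal
      refine ⟨l, fun hlS ↦ ?_, hB l (by omega)⟩
      have t := hc.dist_triangle (u := a) (v := y) (w := l)
      have hly : l ≠ y := by rintro rfl; omega
      have := hS _ ha _ hlS _ hy (by
        rw [e₁, dist_comm, dist_mycielskian_inl_inr hc hly, dist_mycielskian_inl_inl hc,
          dist_comm (u := l)]
        omega)
      simp at this
    · obtain ⟨x, hx, hxy⟩ := exists_adj_ne_of_not_isLeafVert hal hay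
      exact ⟨x, hnA x hx, hnB x hx hxy⟩
  obtain ⟨z, hzA, hzB⟩ := hz
  have hunion := Set.ncard_union_add_ncard_inter {v | some (.inl v) ∈ S} {v | some (.inr v) ∈ S}
  have hinter := Set.ncard_le_ncard hAB
  have hlt : ({v | some (.inl v) ∈ S} ∪ {v | some (.inr v) ∈ S}).ncard < Fintype.card V := by
    rw [← Nat.card_eq_fintype_card]
    refine Set.ncard_lt_card fun h ↦ ?_
    have : z ∈ {v | some (.inl v) ∈ S} ∪ {v | some (.inr v) ∈ S} := h ▸ Set.mem_univ z
    exact this.elim hzA hzB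
  rw [Set.ncard_singleton] at hinter
  rw [ncard_mycielskian_eq_of_none_notMem hroot]
  omega

lemma ncard_le_of_forall_adj_twin_notMem (hT : T.IsTree) (hS : IsGPSet (Mycielskian T) S)
    (hroot : none ∉ S) (hAB : ∀ a y, T.Adj a y → some (.inl a) ∈ S → some (.inr y) ∉ S)
    {R : Set V} (hR : ∀ l ∈ R, ∀ l' ∈ R, ∀ y, T.Adj y l → T.Adj y l' → l = l') :
    S.ncard ≤ Fintype.card V + ({l | IsLeafVert T l} \ R).ncard := by
  have hc := hT.connected
  rw [isGPSet_iff_dist (mycielskian_connected hc)] at hS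
  have hcard := ncard_mycielskian_eq_of_none_notMem hroot
  set A : Set V := {v | some (.inl v) ∈ S}
  set B : Set V := {v | some (.inr v) ∈ S}
  set L : Set V := {l | IsLeafVert T l}
  obtain ⟨f, hf, hinj⟩ := exists_injOn_adj hT (A \ (L \ R)) (by
      rintro l ⟨-, hl⟩ l' ⟨-, hl'⟩ hlL hlL' y hy hy'
      exact hR l (by_contra fun h ↦ hl ⟨hlL, h⟩) l' (by_contra fun h ↦ hl' ⟨hlL', h⟩) y hy hy') (by
      rintro a ⟨ha, -⟩ b ⟨hb, -⟩ c ⟨hc', -⟩ x y hax hxb hby hyc hab hxy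
      by_contra hbc
      have := hS _ ha _ hc' _ hb (by
        rw [dist_mycielskian_inl_inl hc, dist_mycielskian_inl_inl hc, dist_mycielskian_inl_inl hc,
          hT.dist_eq_two hax hxb hab, hT.dist_eq_two hby hyc hbc,
          hT.dist_eq_four hax hxb hby hyc hab hxy hbc]; rfl)
      simp [hbc, Ne.symm hab] at this)
  have h₁ : (A \ (L \ R)).ncard + B.ncard ≤ Fintype.card V := by
    rw [← hinj.ncard_image, ← Set.ncard_union_eq, ← Nat.card_eq_fintype_card]
    · exact Set.ncard_le_card _
    · rw [Set.disjoint_left]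
      rintro _ ⟨a, ha, rfl⟩
      exact hAB a _ (hf a ha) ha.1
  have h₂ : A.ncard ≤ (A \ (L \ R)).ncard + (L \ R).ncard :=
    (Set.ncard_le_ncard (fun x hx ↦ by by_cases h : x ∈ L \ R <;> simp [h, hx])).trans
      (Set.ncard_union_le _ _)
  omega

end UpperBound

section LowerBound

variable {T : SimpleGraph V}

/-- The twins of the vertices that are not next-to-terminal, together with the leaves. -/
def twinLeafSet (T : SimpleGraph V) : Set (Option (V ⊕ V))
  | none => False
  | some (.inl v) => IsLeafVert T v
  | some (.inr v) => ¬ IsNTVert T v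

@[simp] lemma none_notMem_twinLeafSet : none ∉ twinLeafSet T := fun h ↦ h

@[simp] lemma inl_mem_twinLeafSet {v : V} :
    some (.inl v) ∈ twinLeafSet T ↔ IsLeafVert T v := Iff.rfl

@[simp] lemma inr_mem_twinLeafSet {v : V} :
    some (.inr v) ∈ twinLeafSet T ↔ ¬ IsNTVert T v := Iff.rfl

lemma ncard_twinLeafSet [Fintype V] : (twinLeafSet T).ncard =
    {v | IsLeafVert T v}.ncard + (Fintype.card V - {v | IsNTVert T v}.ncard) := by
  rw [ncard_mycielskian_eq_of_none_notMem none_notMem_twinLeafSet, ← Nat.card_eq_fintype_card,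
    ← Set.ncard_compl]
  rfl

/-- If the distance of two leaves is never `1`, `3` or `4`, then the twins of the vertices that
are not next-to-terminal and the leaves are in general position. -/
lemma isGPSet_twinLeafSet [Nontrivial V] (hc : T.Connected)
    (hleaf : ∀ a b, IsLeafVert T a → IsLeafVert T b → a ≠ b →
      T.dist a b = 2 ∨ 5 ≤ T.dist a b) :
    IsGPSet (Mycielskian T) (twinLeafSet T) := by
  rw [isGPSet_iff_dist (mycielskian_connected hc)]
  have hnt : ∀ l v, IsLeafVert T l → ¬ IsNTVert T v → T.dist l v ≠ 1 := fun l v hl hv h ↦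
    hv ⟨l, (dist_eq_one_iff_adj.1 h).symm, hl⟩
  have hlr : ∀ l v, IsLeafVert T l → ¬ IsNTVert T v →
      2 ≤ (Mycielskian T).dist (some (.inl l)) (some (.inr v)) ∧
      (Mycielskian T).dist (some (.inl l)) (some (.inr v)) ≤ 3 ∧
      ((Mycielskian T).dist (some (.inl l)) (some (.inr v)) = 2 → T.dist l v ≤ 2) := by
    intro l v hl hv
    by_cases h : l = v
    · subst h
      simp [dist_mycielskian_inl_inr_self hc]
    · rw [dist_mycielskian_inl_inr hc h]
      have := hc.pos_dist_of_ne h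
      have := hnt l v hl hv
      omega
  have hsymm : ∀ l v, (Mycielskian T).dist (some (.inr v)) (some (.inl l)) =
      (Mycielskian T).dist (some (.inl l)) (some (.inr v)) := fun l v ↦ SimpleGraph.dist_comm
  rintro (_ | a | a) ha (_ | b | b) hb (_ | w | w) hw hd <;>
    simp only [none_notMem_twinLeafSet, inl_mem_twinLeafSet, inr_mem_twinLeafSet] at ha hb hw <;>
    by_contra! hne <;> simp only [ne_eq, Option.some.injEq, Sum.inl.injEq, Sum.inr.injEq,
      reduceCtorEq, not_false_eq_true, and_true, true_and, and_self] at hne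
  · rw [dist_mycielskian_inl_inl hc, dist_mycielskian_inl_inl hc,
      dist_mycielskian_inl_inl hc] at hd
    have h₁ := hleaf a w ha hw (Ne.symm hne.1)
    have h₂ := hleaf w b hw hb hne.2
    have t := hc.dist_triangle (u := a) (v := w) (w := b)
    by_cases hab : a = b
    · subst hab; rw [SimpleGraph.dist_self] at hd; omega
    have h₃ := hleaf a b ha hb hab
    omega
  · have h₁ := hlr a w ha hw
    have h₂ := hlr b w hb hw
    rw [hsymm, dist_mycielskian_inl_inl hc] at hd
    have t := hc.dist_triangle (u := a) (v := w) (w := b)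
    rw [SimpleGraph.dist_comm (u := w)] at t
    by_cases hab : a = b
    · subst hab; rw [SimpleGraph.dist_self] at hd; omega
    have h₃ := hleaf a b ha hb hab
    omega
  · have h₁ := hlr a b ha hb
    have h₂ := hlr w b hw hb
    have h₃ := hleaf a w ha hw (Ne.symm hne)
    rw [dist_mycielskian_inl_inl hc] at hd
    omega
  · have h₁ := hlr a b ha hb
    have h₂ := hlr a w ha hw
    rw [dist_mycielskian_inr_inr hc hne] at hd
    omega
  · have h₁ := hlr b a hb ha
    have h₂ := hlr w a hw ha
    have h₃ := hleaf w b hw hb hne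
    rw [hsymm, hsymm, dist_mycielskian_inl_inl hc] at hd
    omega
  · have h₁ := hlr b a hb ha
    have h₂ := hlr b w hb hw
    rw [dist_mycielskian_inr_inr hc (Ne.symm hne), hsymm, hsymm] at hd
    omega
  · have h₁ := hlr w a hw ha
    have h₂ := hlr w b hw hb
    rw [hsymm] at hd
    by_cases hab : a = b
    · subst hab; rw [SimpleGraph.dist_self] at hd; omega
    rw [dist_mycielskian_inr_inr hc hab] at hd
    omega
  · rw [dist_mycielskian_inr_inr hc (Ne.symm hne.1), dist_mycielskian_inr_inr hc hne.2] at hd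
    by_cases hab : a = b
    · subst hab; simp at hd
    rw [dist_mycielskian_inr_inr hc hab] at hd
    omega

end LowerBound

/-- Let `T` be a tree of order `n ≥ 3` with `ℓ` leaves and `w ≥ 2` NT
vertices in which any two leaves adjacent to distinct NT vertices are at distance at
least `5` (i.e. `D_T ≥ 5`). Then `gp(μ(T)) = n + ℓ - w`. -/
theorem gpNumber_mycielskian_tree_eq [Fintype V] (T : SimpleGraph V)
    (hT : T.IsTree) (hn : 3 ≤ Fintype.card V)
    (hw : 2 ≤ {v | IsNTVert T v}.ncard)
    (hD : ∀ l l' y y' : V, IsLeafVert T l → IsLeafVert T l' →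
      T.Adj y l → T.Adj y' l' → y ≠ y' → 5 ≤ T.dist l l') :
    gpNumber (Mycielskian T) =
      Fintype.card V + {v | IsLeafVert T v}.ncard - {v | IsNTVert T v}.ncard := by
  have hc := hT.connected
  have : Nontrivial V := Fintype.one_lt_card_iff_nontrivial.1 (by omega)
  obtain ⟨y₁, ⟨l₁, h₁, hl₁⟩, y₂, ⟨l₂, h₂, hl₂⟩, hy⟩ :=
    (Set.one_lt_ncard (Set.toFinite {v | IsNTVert T v})).1 hw
  have hfar := hD l₁ l₂ y₁ y₂ hl₁ hl₂ h₁ h₂ hy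
  have hnb : ∀ v, ∃ u, T.Adj v u := hc.preconnected.exists_adj_of_nontrivial
  choose! r hr using fun v (hv : IsNTVert T v) ↦ hv
  have hrinj : Set.InjOn r {v | IsNTVert T v} := fun v hv w hw hvw ↦
    (hr v hv).2.eq_of_adj (hr v hv).1.symm (hvw ▸ (hr w hw).1.symm)
  have hrsub : r '' {v | IsNTVert T v} ⊆ {v | IsLeafVert T v} := by
    rintro _ ⟨v, hv, rfl⟩
    exact (hr v hv).2
  have hle := Set.ncard_le_ncard hrsub
  have hdiff := Set.ncard_sdiff hrsub
  rw [hrinj.ncard_image] at hle hdiff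
  refine IsGreatest.csSup_eq ⟨⟨twinLeafSet T, isGPSet_twinLeafSet hc ?_, ?_⟩, ?_⟩
  · intro a b ha hb hab
    obtain ⟨y, hy⟩ := hnb a
    obtain ⟨y', hy'⟩ := hnb b
    by_cases hyy : y = y'
    · subst hyy
      exact .inl (hT.dist_eq_two hy hy'.symm hab)
    · exact .inr (hD a b y y' ha hb hy.symm hy'.symm hyy)
  · have : {v | IsNTVert T v}.ncard ≤ Fintype.card V := by
      rw [← Nat.card_eq_fintype_card]
      exact Set.ncard_le_card _
    rw [ncard_twinLeafSet]
    omega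
  · rintro _ ⟨S, hS, rfl⟩
    by_cases hroot : none ∈ S
    · have := ncard_le_of_none_mem hT hS hroot h₁ h₂ hfar
      omega
    by_cases hAB : ∀ a y, T.Adj a y → some (.inl a) ∈ S → some (.inr y) ∉ S
    · have := ncard_le_of_forall_adj_twin_notMem hT hS hroot hAB
        (R := r '' {v | IsNTVert T v}) (by
          rintro _ ⟨v, hv, rfl⟩ _ ⟨w, hw, rfl⟩ y hy hy'
          rw [(hr v hv).2.eq_of_adj (hr v hv).1.symm hy.symm,
            (hr w hw).2.eq_of_adj (hr w hw).1.symm hy'.symm])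
      omega
    · push Not at hAB
      obtain ⟨a, y, hay, ha, hyS⟩ := hAB
      have := ncard_le_of_adj_twin_mem hT hS hroot hay ha hyS fun hal ↦ by
        by_cases hyy : y = y₁
        · exact ⟨l₂, hD a l₂ y y₂ hal hl₂ hay.symm h₂ (hyy ▸ hy)⟩
        · exact ⟨l₁, hD a l₁ y y₁ hal hl₁ hay.symm h₁ hyy⟩
      omega
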